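/- Fix β ∈ (0,1/2). Let X ∈ {0,1} = F₂ have pmf P_X and let (X,Y₁,Y₂) have joint pmf P_X(x)·W(y₁,y₂|x) for a broadcast channel W with finite output alphabets. Apply the polar construction to (X, Y) with Y = (Y₁,Y₂), and for n = 2^k define the sets H_U^{(n)} = {i : Z(U^i|U^{1:i−1}) ≥ 1 − 2^{−n^β}}, L^{(n)}_{U|Y_m} = {i : Z(U^i | Y_m^{1:n}, U^{1:i−1}) ≤ 2^{−n^β}} for m = 1,2 (where Y_m^{1:n} is the sequence of m-th output coordinates), and the information sets I_m = H_U^{(n)} ∩ L^{(n)}_{U|Y_m}. Then lim_{k→∞} |I_1|/n = I(X;Y₁) and lim_{k→∞} |I_2|/n = I(X;Y₂). -/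

import Mathlib

open scoped BigOperators

noncomputable section

/-- A probability mass function on a finite type. -/
def IsPMF {α : Type*} [Fintype α] (p : α → ℝ) : Prop :=
  (∀ a, 0 ≤ p a) ∧ ∑ a, p a = 1

/-- Shannon entropy (base 2), with the convention `0 * log₂ 0 = 0`. -/
def ent {α : Type*} [Fintype α] (p : α → ℝ) : ℝ :=
  -∑ a, p a * Real.logb 2 (p a)

/-- Marginal of a joint pmf on the second component. -/
def margSnd {α β : Type*} [Fintype α] [Fintype β] (p : α × β → ℝ) : β → ℝ :=
  fun b => ∑ a, p (a, b)

/-- Marginal of a joint pmf on the first component. -/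
def margFst {α β : Type*} [Fintype α] [Fintype β] (p : α × β → ℝ) : α → ℝ :=
  fun a => ∑ b, p (a, b)

/-- Conditional entropy H(X|Y) of a joint pmf on α × β
(terms with `p (a, b) = 0` vanish since `0 * log₂ _ = 0`). -/
def condEnt {α β : Type*} [Fintype α] [Fintype β] (p : α × β → ℝ) : ℝ :=
  -∑ a, ∑ b, p (a, b) * Real.logb 2 (p (a, b) / margSnd p b)

/-- Mutual information I(X;Y) = H(X) - H(X|Y) of a joint pmf on α × β. -/
def mutInfo {α β : Type*} [Fintype α] [Fintype β] (p : α × β → ℝ) : ℝ :=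
  ent (margFst p) - condEnt p

/-- Pushforward of a pmf along a map. -/
def pushPMF {α β : Type*} [Fintype α] [DecidableEq β] (p : α → ℝ) (f : α → β) : β → ℝ :=
  fun b => ∑ a, if f a = b then p a else 0

/-- Entropy H(A) of a random variable A on the finite probability space (Ω, p). -/
def entOf {Ω α : Type*} [Fintype Ω] [Fintype α] [DecidableEq α] (p : Ω → ℝ) (A : Ω → α) : ℝ :=
  ent (pushPMF p A)

/-- Conditional entropy H(A|B) of random variables on (Ω, p). -/
def condEntOf {Ω α β : Type*} [Fintype Ω] [Fintype α] [Fintype β] [DecidableEq α] [DecidableEq β]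
    (p : Ω → ℝ) (A : Ω → α) (B : Ω → β) : ℝ :=
  condEnt (pushPMF p (fun ω => (A ω, B ω)))

/-- Mutual information I(A;B) of random variables on (Ω, p). -/
def mutInfoOf {Ω α β : Type*} [Fintype Ω] [Fintype α] [Fintype β] [DecidableEq α] [DecidableEq β]
    (p : Ω → ℝ) (A : Ω → α) (B : Ω → β) : ℝ :=
  entOf p A - condEntOf p A B

/-- Conditional mutual information I(A;B|C) = H(A|C) - H(A|(B,C)). -/
def condMutInfoOf {Ω α β γ : Type*} [Fintype Ω] [Fintype α] [Fintype β] [Fintype γ]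
    [DecidableEq α] [DecidableEq β] [DecidableEq γ]
    (p : Ω → ℝ) (A : Ω → α) (B : Ω → β) (C : Ω → γ) : ℝ :=
  condEntOf p A C - condEntOf p A (fun ω => (B ω, C ω))

/-- Bhattacharyya parameter Z(X|Y) = 2 ∑_y √(p(0,y) p(1,y)) for binary X. -/
def bhat {β : Type*} [Fintype β] (p : ZMod 2 × β → ℝ) : ℝ :=
  2 * ∑ b, Real.sqrt (p (0, b) * p (1, b))

/-- The polar matrix `G_n`, the k-fold Kronecker power of ((1,0),(1,1)) over F₂. -/
def polarG : ∀ k : ℕ, Matrix (Fin (2 ^ k)) (Fin (2 ^ k)) (ZMod 2)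
  | 0 => 1
  | k + 1 =>
      Matrix.reindex (finProdFinEquiv.trans (finCongr (pow_succ 2 k).symm))
        (finProdFinEquiv.trans (finCongr (pow_succ 2 k).symm))
        (Matrix.kroneckerMap (· * ·) (polarG k)
          (!![1, 0; 1, 1] : Matrix (Fin 2) (Fin 2) (ZMod 2)))

/-- Joint pmf of `n` i.i.d. copies of a pair `(X, Y) ~ p`. -/
def iidPair {β : Type*} [Fintype β] (p : ZMod 2 × β → ℝ) (n : ℕ) :
    (Fin n → ZMod 2) × (Fin n → β) → ℝ :=
  fun xy => ∏ i, p (xy.1 i, xy.2 i)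

/-- The polarized sequence `U^{1:n} = X^{1:n} G_n`. -/
def polarU (k : ℕ) (x : Fin (2 ^ k) → ZMod 2) : Fin (2 ^ k) → ZMod 2 :=
  Matrix.vecMul x (polarG k)

/-- The Bhattacharyya parameter `Z(U^i | Y^{1:n}, U^{1:i-1})`. -/
def polarZ {β : Type*} [Fintype β] [DecidableEq β] (p : ZMod 2 × β → ℝ) (k : ℕ)
    (i : Fin (2 ^ k)) : ℝ :=
  bhat (pushPMF (iidPair p (2 ^ k))
    (fun xy => (polarU k xy.1 i,
      (xy.2, fun j : Fin i.val => polarU k xy.1 (Fin.castLE i.isLt.le j)))))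

/-- The Bhattacharyya parameter `Z(U^i | U^{1:i-1})`. -/
def polarZU {β : Type*} [Fintype β] (p : ZMod 2 × β → ℝ) (k : ℕ)
    (i : Fin (2 ^ k)) : ℝ :=
  bhat (pushPMF (iidPair p (2 ^ k))
    (fun xy => (polarU k xy.1 i,
      fun j : Fin i.val => polarU k xy.1 (Fin.castLE i.isLt.le j))))

/-- The Bhattacharyya parameter `Z(U^i | (obs ∘ Y)^{1:n}, U^{1:i-1})`, where each
output symbol is observed through the map `obs`. -/
def polarZobs {β γ : Type*} [Fintype β] [Fintype γ] [DecidableEq γ] (p : ZMod 2 × β → ℝ)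
    (obs : β → γ) (k : ℕ) (i : Fin (2 ^ k)) : ℝ :=
  bhat (pushPMF (iidPair p (2 ^ k))
    (fun xy => (polarU k xy.1 i,
      (fun j => obs (xy.2 j), fun j : Fin i.val => polarU k xy.1 (Fin.castLE i.isLt.le j)))))

/-- The bijection sending a node at level `k` and a bit to the corresponding child node. -/
def child (k : ℕ) : Fin (2 ^ k) × Fin 2 ≃ Fin (2 ^ (k + 1)) :=
  finProdFinEquiv.trans (finCongr (pow_succ 2 k).symm)

/-- Average over the nodes at level `k`. -/
def avg (k : ℕ) (f : Fin (2 ^ k) → ℝ) : ℝ := (∑ i, f i) / 2 ^ k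

open Classical in
/-- Fraction of the nodes at level `k` that satisfy `P`. -/
def frac (k : ℕ) (P : Fin (2 ^ k) → Prop) : ℝ := avg k (fun i => if P i then 1 else 0)

lemma avg_succ {k : ℕ} (f : Fin (2 ^ (k + 1)) → ℝ) :
    avg (k + 1) f = avg k (fun i => (f (child k (i, 0)) + f (child k (i, 1))) / 2) := by
  unfold avg
  rw [← (child k).sum_comp, Fintype.sum_prod_type]
  simp only [Fin.sum_univ_two, ← Finset.sum_div]
  rw [div_div]
  exact congrArg _ (pow_succ' 2 k)

lemma avg_mono {k : ℕ} {f g : Fin (2 ^ k) → ℝ} (h : ∀ i, f i ≤ g i) : avg k f ≤ avg k g := by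
  unfold avg
  gcongr with i
  exact h i

lemma avg_add {k : ℕ} (f g : Fin (2 ^ k) → ℝ) :
    avg k (fun i => f i + g i) = avg k f + avg k g := by
  simp only [avg, Finset.sum_add_distrib, add_div]

lemma avg_mul_left {k : ℕ} (c : ℝ) (f : Fin (2 ^ k) → ℝ) :
    avg k (fun i => c * f i) = c * avg k f := by
  simp only [avg, ← Finset.mul_sum, mul_div_assoc]

lemma avg_const {k : ℕ} (c : ℝ) : avg k (fun _ => c) = c := by
  simp [avg]

lemma avg_zero (f : Fin (2 ^ 0) → ℝ) : avg 0 f = f 0 := by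
  simp [avg]

lemma frac_mono {k : ℕ} {P Q : Fin (2 ^ k) → Prop} (h : ∀ i, P i → Q i) :
    frac k P ≤ frac k Q := by
  classical
  refine avg_mono fun i => ?_
  by_cases hP : P i
  · simp [hP, h i hP]
  · simp only [hP, if_false]
    split_ifs <;> norm_num

lemma frac_le_one {k : ℕ} (P : Fin (2 ^ k) → Prop) : frac k P ≤ 1 := by
  classical
  refine (avg_mono (g := fun _ => 1) fun i => ?_).trans_eq (avg_const 1)
  split_ifs <;> norm_num

lemma one_le_frac_add {k : ℕ} {P Q : Fin (2 ^ k) → Prop} (h : ∀ i, P i ∨ Q i) :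
    1 ≤ frac k P + frac k Q := by
  classical
  rw [frac, frac, ← avg_add]
  refine (avg_const 1).symm.trans_le (avg_mono fun i => ?_)
  rcases h i with h | h <;> simp only [h, if_true] <;> split_ifs <;> norm_num

lemma frac_le_add {k : ℕ} {P Q R : Fin (2 ^ k) → Prop} (h : ∀ i, P i → Q i ∨ R i) :
    frac k P ≤ frac k Q + frac k R := by
  classical
  rw [frac, frac, frac, ← avg_add]
  refine avg_mono fun i => ?_
  by_cases hP : P i
  · rcases h i hP with h | h <;> simp only [h, if_true, hP] <;> split_ifs <;> norm_num
  · simp only [hP, if_false]; split_ifs <;> norm_num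

lemma frac_and {k : ℕ} (P Q : Fin (2 ^ k) → Prop) :
    frac k P + frac k Q ≤ 1 + frac k (fun i => P i ∧ Q i) := by
  classical
  rw [frac, frac, frac, ← avg_add]
  refine (avg_mono fun i => ?_).trans_eq ((avg_add (fun _ => 1) (fun i => if P i ∧ Q i then 1 else 0)).trans
    (by rw [avg_const]; congr!))
  by_cases hP : P i <;> by_cases hQ : Q i <;> simp [hP, hQ]

lemma frac_add_le_one {k : ℕ} {P Q R : Fin (2 ^ k) → Prop} (hPQ : ∀ i, P i → ¬ Q i)
    (hPR : ∀ i, P i → ¬ R i) (hQR : ∀ i, Q i → ¬ R i) :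
    frac k P + frac k Q + frac k R ≤ 1 := by
  classical
  rw [frac, frac, frac, ← avg_add, ← avg_add]
  refine (avg_mono fun i => ?_).trans_eq (avg_const 1)
  have h1 := hPQ i
  have h2 := hPR i
  have h3 := hQR i
  by_cases hP : P i <;> by_cases hQ : Q i <;> by_cases hR : R i <;> simp_all

/-- Markov's inequality. -/
lemma frac_mul_le_avg {k : ℕ} {f : Fin (2 ^ k) → ℝ} (hf : ∀ i, 0 ≤ f i) {c : ℝ}
    {P : Fin (2 ^ k) → Prop} (hP : ∀ i, P i → c ≤ f i) : c * frac k P ≤ avg k f := by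
  classical
  rw [frac, ← avg_mul_left]
  refine avg_mono fun i => ?_
  by_cases h : P i
  · simpa [h] using hP i h
  · simpa [h] using hf i

lemma natCard_div_eq_frac (k : ℕ) (P : Fin (2 ^ k) → Prop) :
    (Nat.card {i // P i} : ℝ) / ((2 ^ k : ℕ) : ℝ) = frac k P := by
  classical
  rw [frac, avg, Nat.card_eq_fintype_card, Fintype.card_subtype]
  simp

/-- Ancestor at level `m` of a node at level `m + l`. -/
def ancestor (m : ℕ) : ∀ l : ℕ, Fin (2 ^ (m + l)) → Fin (2 ^ m)
  | 0, i => i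
  | l + 1, i => ancestor m l ((child (m + l)).symm i).1

/-- Number of bits equal to `s` on the path from level `m` to a node at level `m + l`. -/
def bitCount (m : ℕ) (s : Fin 2) : ∀ l : ℕ, Fin (2 ^ (m + l)) → ℕ
  | 0, _ => 0
  | l + 1, i => bitCount m s l ((child (m + l)).symm i).1 +
      if ((child (m + l)).symm i).2 = s then 1 else 0

lemma avg_ancestor (m l : ℕ) (f : Fin (2 ^ m) → ℝ) :
    avg (m + l) (fun i => f (ancestor m l i)) = avg m f := by
  induction l with
  | zero => rfl
  | succ l ih =>
    rw [← ih]
    refine (avg_succ _).trans ?_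
    simp [ancestor]

lemma avg_bitCount_sq (m : ℕ) (s : Fin 2) (l : ℕ) :
    avg (m + l) (fun i => (2 * (bitCount m s l i : ℝ) - l) ^ 2) = l := by
  induction l with
  | zero => simp [bitCount, avg]
  | succ l ih =>
    refine (avg_succ _).trans ?_
    have : ∀ i : Fin (2 ^ (m + l)),
        ((2 * (bitCount m s (l + 1) (child (m + l) (i, 0)) : ℝ) - (l + 1 : ℕ)) ^ 2 +
          (2 * (bitCount m s (l + 1) (child (m + l) (i, 1)) : ℝ) - (l + 1 : ℕ)) ^ 2) / 2
        = (2 * (bitCount m s l i : ℝ) - l) ^ 2 + 1 := by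
      intro i
      fin_cases s <;> simp [bitCount] <;> ring
    calc _ = avg (m + l) (fun i => (2 * (bitCount m s l i : ℝ) - l) ^ 2 + 1) :=
          congrArg _ (funext this)
      _ = _ := by rw [avg_add, ih, avg_const]; push_cast; rfl

/-- Chebyshev's inequality for the number of bits equal to `s`. -/
lemma frac_bitCount_lt_le (m : ℕ) (s : Fin 2) {l j : ℕ} (hj : 2 * j < l) :
    frac (m + l) (fun i => bitCount m s l i < j) ≤ l / ((l : ℝ) - 2 * j) ^ 2 := by
  have hj' : (2 : ℝ) * j < l := by exact_mod_cast hj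
  rw [le_div_iff₀ (by nlinarith), mul_comm]
  refine (frac_mul_le_avg (fun i => sq_nonneg _) fun i hi => ?_).trans_eq
    (avg_bitCount_sq m s l)
  have hi' : (bitCount m s l i : ℝ) ≤ j := by exact_mod_cast hi.le
  nlinarith

/-- A process on the binary tree that is squared along the bit `s` and at most doubled along the
other bit. -/
structure SquareOrDouble (s : Fin 2) (T : ∀ k, Fin (2 ^ k) → ℝ) : Prop where
  nonneg : ∀ k i, 0 ≤ T k i
  step : ∀ k i d, T (k + 1) (child k (i, d)) ≤ if d = s then T k i ^ 2 else 2 * T k i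

namespace SquareOrDouble

variable {s : Fin 2} {T : ∀ k, Fin (2 ^ k) → ℝ}

lemma le_pow (hT : SquareOrDouble s T) (m l : ℕ) (i : Fin (2 ^ (m + l))) :
    T (m + l) i ≤ (2 ^ l * T m (ancestor m l i)) ^ 2 ^ bitCount m s l i := by
  induction l with
  | zero => simp [ancestor, bitCount]
  | succ l ih =>
    obtain ⟨⟨i, d⟩, rfl⟩ := (child (m + l)).surjective i
    refine (hT.step (m + l) i d).trans ?_
    have h0 := hT.nonneg m (ancestor m l i)
    have h1 := hT.nonneg (m + l) i
    by_cases hd : d = s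
    · simp only [hd, ancestor, bitCount, Equiv.symm_apply_apply, if_true, pow_succ _ (bitCount _ _ _ _),
        pow_mul]
      refine (pow_le_pow_left₀ h1 (ih i) 2).trans ?_
      gcongr <;> norm_num
    · simp only [hd, ancestor, bitCount, Equiv.symm_apply_apply, if_false, add_zero]
      calc 2 * T (m + l) i ≤ 2 ^ 2 ^ bitCount m s l i *
            (2 ^ l * T m (ancestor m l i)) ^ 2 ^ bitCount m s l i := by
            gcongr
            · exact le_self_pow₀ (by norm_num) (by positivity)
            · exact ih i
        _ = _ := by rw [← mul_pow, pow_succ' 2 l, mul_assoc]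

lemma frac_le_pow (hT : SquareOrDouble s T) {m l j : ℕ} (hj : 2 * j < l) {x : ℝ}
    (hx : 2 ^ l * x ≤ 1) :
    frac m (fun i => T m i ≤ x) - l / ((l : ℝ) - 2 * j) ^ 2 ≤
      frac (m + l) (fun i => T (m + l) i ≤ (2 ^ l * x) ^ 2 ^ j) := by
  have h1 := frac_bitCount_lt_le m s hj
  have h2 : frac m (fun i => T m i ≤ x) =
      frac (m + l) (fun i => T m (ancestor m l i) ≤ x) := (avg_ancestor m l _).symm
  have h3 : frac (m + l) (fun i => T m (ancestor m l i) ≤ x) ≤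
      frac (m + l) (fun i => T (m + l) i ≤ (2 ^ l * x) ^ 2 ^ j) +
        frac (m + l) (fun i => bitCount m s l i < j) := by
    refine frac_le_add fun i hi => ?_
    by_cases hb : bitCount m s l i < j
    · exact Or.inr hb
    left
    have h0 := hT.nonneg m (ancestor m l i)
    refine (hT.le_pow m l i).trans ?_
    calc (2 ^ l * T m (ancestor m l i)) ^ 2 ^ bitCount m s l i
        ≤ (2 ^ l * x) ^ 2 ^ bitCount m s l i := by gcongr
      _ ≤ _ := pow_le_pow_of_le_one (mul_nonneg (by positivity) (h0.trans hi)) hx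
        (Nat.pow_le_pow_right (by norm_num) (not_lt.1 hb))
  linarith

/-- Geometric decay at one rate on a fraction `f` of the nodes bootstraps to every rate. -/
lemma eventually_frac_geometric (hT : SquareOrDouble s T) {f r : ℝ} (hr0 : 0 < r) (hr : r < 1)
    (h : ∀ ε > 0, ∀ᶠ m in Filter.atTop, f - ε ≤ frac m (fun i => T m i ≤ r ^ m))
    {q : ℝ} (hq0 : 0 < q) {ε : ℝ} (hε : 0 < ε) :
    ∀ᶠ m in Filter.atTop, f - ε ≤ frac m (fun i => T m i ≤ q ^ m) := by
  obtain ⟨j, hj1, hj2⟩ : ∃ j : ℕ, r ^ 2 ^ j < q ∧ 2 / ε < j := by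
    have h1 : Filter.Tendsto (fun j : ℕ => r ^ 2 ^ j) Filter.atTop (nhds 0) :=
      (tendsto_pow_atTop_nhds_zero_of_lt_one hr0.le hr).comp
        (tendsto_pow_atTop_atTop_of_one_lt (by norm_num))
    exact ((h1.eventually (gt_mem_nhds hq0)).and
      (tendsto_natCast_atTop_atTop.eventually_gt_atTop (2 / ε))).exists
  have hj0 : (0 : ℝ) < j := lt_trans (by positivity) hj2
  have hjn : 0 < j := by exact_mod_cast hj0
  have hlim1 : Filter.Tendsto (fun m : ℕ => 2 ^ (4 * j) * r ^ m) Filter.atTop (nhds 0) := by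
    simpa using (tendsto_pow_atTop_nhds_zero_of_lt_one hr0.le hr).const_mul ((2 : ℝ) ^ (4 * j))
  have hlim2 : Filter.Tendsto
      (fun m : ℕ => (2 ^ (4 * j)) ^ 2 ^ j * (r ^ 2 ^ j / q) ^ m) Filter.atTop (nhds 0) := by
    have := tendsto_pow_atTop_nhds_zero_of_lt_one (r := r ^ 2 ^ j / q) (by positivity)
      ((div_lt_one hq0).2 hj1)
    simpa using this.const_mul (((2 : ℝ) ^ (4 * j)) ^ 2 ^ j)
  have hev : ∀ᶠ m in Filter.atTop,
      f - ε ≤ frac (m + 4 * j) (fun i => T (m + 4 * j) i ≤ q ^ (m + 4 * j)) := by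
    filter_upwards [h (ε / 2) (by positivity), hlim1.eventually (gt_mem_nhds one_pos),
      hlim2.eventually (gt_mem_nhds (pow_pos hq0 (4 * j)))] with m h1 h2 h3
    have h4 := hT.frac_le_pow (m := m) (l := 4 * j) (j := j) (by omega) h2.le
    have h5 : ((4 * j : ℕ) : ℝ) / (((4 * j : ℕ) : ℝ) - 2 * j) ^ 2 ≤ ε / 2 := by
      push_cast
      rw [div_le_iff₀ (by nlinarith)]
      rw [div_lt_iff₀ hε] at hj2
      nlinarith
    have h6 : (2 ^ (4 * j) * r ^ m) ^ 2 ^ j ≤ q ^ (m + 4 * j) := by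
      rw [mul_pow, ← pow_mul r, mul_comm m, pow_mul r]
      rw [div_pow, ← mul_div_assoc, div_lt_iff₀ (by positivity)] at h3
      rw [pow_add, mul_comm (q ^ m)]
      exact h3.le
    have h7 := frac_mono (k := m + 4 * j)
      (P := fun i => T (m + 4 * j) i ≤ (2 ^ (4 * j) * r ^ m) ^ 2 ^ j)
      (Q := fun i => T (m + 4 * j) i ≤ q ^ (m + 4 * j)) fun i hi => hi.trans h6
    linarith
  rw [← Filter.map_add_atTop_eq_nat (4 * j)]
  exact Filter.eventually_map.2 hev

/-- Geometric decay on a fraction `f` of the nodes bootstraps to decay as `2 ^ (-(2 ^ k) ^ b)` for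
every `b < 1 / 2`. -/
lemma eventually_frac_doubly_exponential (hT : SquareOrDouble s T) {f r : ℝ} (hr0 : 0 < r)
    (hr : r < 1) (h : ∀ ε > 0, ∀ᶠ m in Filter.atTop, f - ε ≤ frac m (fun i => T m i ≤ r ^ m))
    {b : ℝ} (hb0 : 0 < b) (hb : b < 1 / 2) {ε : ℝ} (hε : 0 < ε) :
    ∀ᶠ k in Filter.atTop, f - ε ≤
      frac k (fun i => T k i ≤ Real.rpow 2 (-(Real.rpow ((2 ^ k : ℕ) : ℝ) b))) := by
  obtain ⟨q, hq⟩ := exists_nat_gt (2 / (1 - 2 * b))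
  have hb' : 0 < 1 - 2 * b := by linarith
  have hq0 : (0 : ℝ) < q := lt_trans (by positivity) hq
  have hqn : 0 < q := by exact_mod_cast hq0
  rw [div_lt_iff₀ hb'] at hq
  have hgeo := hT.eventually_frac_geometric hr0 hr h (q := (1 / 2) ^ (2 * q)) (by positivity)
    (half_pos hε)
  have hdiv : Filter.Tendsto (fun k : ℕ => k / q) Filter.atTop Filter.atTop :=
    Filter.tendsto_atTop.2 fun n => by
      filter_upwards [Filter.eventually_ge_atTop (n * q)] with k hk
      exact (Nat.le_div_iff_mul_le hqn).2 hk
  filter_upwards [hdiv.eventually hgeo, Filter.eventually_ge_atTop (2 * q + 1),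
    Filter.eventually_ge_atTop (4 * q),
    tendsto_natCast_atTop_atTop.eventually_ge_atTop (8 * q ^ 2 / ε)] with k h1 h2 h3 h4
  obtain ⟨l, hl⟩ : ∃ l, k = k / q + l := ⟨k - k / q, by have := Nat.div_le_self k q; omega⟩
  have hk0 : (0 : ℝ) < k := by
    have : 0 < k := by omega
    exact_mod_cast this
  have hml := Nat.div_mul_le_self k q
  have hmu := Nat.lt_div_mul_add (a := k) hqn
  generalize k / q = m at *
  subst hl
  set j := ⌈b * (m + l : ℕ)⌉₊ with hj
  have hj1 : b * (m + l : ℕ) ≤ j := Nat.le_ceil _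
  have hj2 : (j : ℝ) < b * (m + l : ℕ) + 1 := Nat.ceil_lt_add_one (by positivity)
  have hml' : (m : ℝ) * q ≤ (m + l : ℕ) := by exact_mod_cast hml
  have h3' : (4 : ℝ) * q ≤ (m + l : ℕ) := by exact_mod_cast h3
  have hkl : ((m + l : ℕ) : ℝ) = m + l := by push_cast; ring
  set n : ℝ := ((m + l : ℕ) : ℝ) with hn
  have hgap : n / (2 * q) ≤ (l : ℝ) - 2 * j := by
    rw [div_le_iff₀ (by positivity)]
    nlinarith
  have hgap0 : 0 < n / (2 * q) := by positivity
  have hjl : 2 * j < l := by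
    have : (2 : ℝ) * j < l := by linarith
    exact_mod_cast this
  have hx : (2 : ℝ) ^ l * ((1 / 2) ^ (2 * q)) ^ m ≤ 1 / 2 := by
    rw [← pow_mul, one_div, inv_pow, ← div_eq_mul_inv, div_le_iff₀ (by positivity)]
    have : l + 1 ≤ 2 * q * m := by nlinarith
    calc (2 : ℝ) ^ l = 2⁻¹ * 2 ^ (l + 1) := by rw [pow_succ]; ring
      _ ≤ 2⁻¹ * 2 ^ (2 * q * m) := by gcongr; norm_num
  have hmain := hT.frac_le_pow (m := m) hjl (hx.trans (by norm_num))
  have herr : (l : ℝ) / ((l : ℝ) - 2 * j) ^ 2 ≤ ε / 2 := by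
    have hln : (l : ℝ) ≤ n := by rw [hkl]; linarith [(Nat.cast_nonneg m : (0 : ℝ) ≤ m)]
    calc (l : ℝ) / ((l : ℝ) - 2 * j) ^ 2 ≤ n / (n / (2 * q)) ^ 2 := by gcongr
      _ = 4 * q ^ 2 / n := by field_simp; ring
      _ ≤ ε / 2 := by
        rw [div_le_iff₀ hε] at h4
        rw [div_le_iff₀ hk0]
        linarith
  refine le_trans ?_ (frac_mono (P := fun i => T (m + l) i ≤
    (2 ^ l * ((1 / 2) ^ (2 * q)) ^ m) ^ 2 ^ j) fun i hi => hi.trans ?_)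
  · linarith
  · calc ((2 : ℝ) ^ l * ((1 / 2) ^ (2 * q)) ^ m) ^ 2 ^ j ≤ (1 / 2) ^ 2 ^ j := by gcongr
      _ = (2 : ℝ) ^ (-((2 : ℝ) ^ (j : ℝ))) := by
        rw [Real.rpow_natCast, Real.rpow_neg (by norm_num), one_div, inv_pow]
        congr 1
        rw [← Real.rpow_natCast]
        push_cast; rfl
      _ ≤ (2 : ℝ) ^ (-(((2 ^ (m + l) : ℕ) : ℝ) ^ b)) := by
        refine Real.rpow_le_rpow_of_exponent_le (by norm_num) (neg_le_neg ?_)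
        rw [Nat.cast_pow, Nat.cast_ofNat, ← Real.rpow_natCast, ← Real.rpow_mul (by norm_num),
          mul_comm]
        exact Real.rpow_le_rpow_of_exponent_le (by norm_num) hj1

end SquareOrDouble

/-- Contraction of the potential `√(z k)` in one polarization step. -/
lemma sqrt_potential_le {z k : ℝ} (hz : 0 ≤ z) (hk : 0 ≤ k) (h : z ^ 2 + k ^ 2 ≤ 1) :
    √(z ^ 2 * (2 * k - k ^ 2)) + √((2 * z - z ^ 2) * k ^ 2) ≤ 2 * (99 / 100) ^ 2 * √(z * k) := by
  have hz1 : z ≤ 1 := by nlinarith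
  have hk1 : k ≤ 1 := by nlinarith
  have hu : 0 ≤ z * (2 - k) := mul_nonneg hz (by linarith)
  have hv : 0 ≤ (2 - z) * k := mul_nonneg (by linarith) hk
  have e1 : z ^ 2 * (2 * k - k ^ 2) = (z * k) * (z * (2 - k)) := by ring
  have e2 : (2 * z - z ^ 2) * k ^ 2 = (z * k) * ((2 - z) * k) := by ring
  have hzk : 0 ≤ z * k := mul_nonneg hz hk
  rw [e1, e2, Real.sqrt_mul hzk, Real.sqrt_mul hzk, ← mul_add, mul_comm]
  refine mul_le_mul_of_nonneg_right ?_ (Real.sqrt_nonneg _)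
  have hq : z * k ≤ 1 / 2 := by nlinarith [sq_nonneg (z - k)]
  have ht : z + k ≤ 3 / 2 := by nlinarith [sq_nonneg (z - k)]
  have hprod : √(z * (2 - k)) * √((2 - z) * k) ≤ z * k + (4 - 2 * (z + k)) / 2 - 1 / 12 := by
    rw [← Real.sqrt_mul hu]
    refine Real.sqrt_le_iff.2 ⟨by nlinarith, ?_⟩
    have : z * (2 - k) * ((2 - z) * k) = (z * k) ^ 2 + (z * k) * (4 - 2 * (z + k)) := by ring
    rw [this]
    nlinarith
  refine abs_le_of_sq_le_sq' ?_ (by norm_num) |>.2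
  nlinarith [Real.sq_sqrt hu, Real.sq_sqrt hv]

/-- The abstract properties of the Bhattacharyya parameters `Z`, variational distances `K` and
conditional entropies `H` on the polarization tree. -/
structure PolarProcess (Z K H : ∀ k, Fin (2 ^ k) → ℝ) : Prop where
  Z_nonneg : ∀ k i, 0 ≤ Z k i
  K_nonneg : ∀ k i, 0 ≤ K k i
  sq_add_sq_le : ∀ k i, Z k i ^ 2 + K k i ^ 2 ≤ 1
  one_le_add : ∀ k i, 1 ≤ Z k i + K k i
  Z_minus : ∀ k i, Z (k + 1) (child k (i, 0)) ≤ 2 * Z k i - Z k i ^ 2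
  Z_plus : ∀ k i, Z (k + 1) (child k (i, 1)) = Z k i ^ 2
  K_minus : ∀ k i, K (k + 1) (child k (i, 0)) = K k i ^ 2
  K_plus : ∀ k i, K (k + 1) (child k (i, 1)) ≤ 2 * K k i - K k i ^ 2
  H_add : ∀ k i, H (k + 1) (child k (i, 0)) + H (k + 1) (child k (i, 1)) = 2 * H k i
  H_le_one : ∀ k i, H k i ≤ 1
  H_le_Z : ∀ k i, H k i ≤ 3 * Z k i
  one_sub_K_le : ∀ k i, 1 - K k i ≤ H k i

namespace PolarProcess

variable {Z K H : ∀ k, Fin (2 ^ k) → ℝ}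

lemma squareOrDouble_Z (h : PolarProcess Z K H) : SquareOrDouble 1 Z where
  nonneg := h.Z_nonneg
  step k i d := by
    fin_cases d
    · simpa using (h.Z_minus k i).trans (by nlinarith)
    · simpa using (h.Z_plus k i).le

lemma squareOrDouble_K (h : PolarProcess Z K H) : SquareOrDouble 0 K where
  nonneg := h.K_nonneg
  step k i d := by
    fin_cases d
    · simpa using (h.K_minus k i).le
    · simpa using (h.K_plus k i).trans (by nlinarith)

lemma avg_H (h : PolarProcess Z K H) (k : ℕ) : avg k (H k) = H 0 0 := by
  induction k with
  | zero => exact avg_zero _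
  | succ k ih =>
    rw [avg_succ, ← ih]
    congr 1
    ext i
    rw [h.H_add]; ring

lemma avg_sqrt_le (h : PolarProcess Z K H) (k : ℕ) :
    avg k (fun i => √(Z k i * K k i)) ≤ ((99 / 100) ^ 2) ^ k := by
  induction k with
  | zero =>
    rw [avg_zero, pow_zero ((99 / 100 : ℝ) ^ 2)]
    refine Real.sqrt_le_one.2 ?_
    nlinarith [h.sq_add_sq_le 0 0, sq_nonneg (Z 0 0 - K 0 0)]
  | succ k ih =>
    rw [avg_succ, pow_succ' ((99 / 100 : ℝ) ^ 2)]
    refine le_trans ?_ (mul_le_mul_of_nonneg_left ih (by norm_num))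
    rw [← avg_mul_left]
    refine avg_mono fun i => ?_
    have h1 := sqrt_potential_le (h.Z_nonneg k i) (h.K_nonneg k i) (h.sq_add_sq_le k i)
    have h2 : √(Z (k + 1) (child k (i, 0)) * K (k + 1) (child k (i, 0))) ≤
        √((2 * Z k i - Z k i ^ 2) * K k i ^ 2) := by
      rw [h.K_minus]
      gcongr
      exact h.Z_minus k i
    have h3 : √(Z (k + 1) (child k (i, 1)) * K (k + 1) (child k (i, 1))) ≤
        √(Z k i ^ 2 * (2 * K k i - K k i ^ 2)) := by
      rw [h.Z_plus]
      gcongr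
      exact h.K_plus k i
    linarith

/-- All but a geometrically small fraction of the nodes have a geometrically small `Z` or `K`. -/
lemma eventually_polarized (h : PolarProcess Z K H) :
    ∀ᶠ m in Filter.atTop, 1 - (99 / 100) ^ m ≤
      frac m (fun i => Z m i ≤ (99 / 100) ^ m) + frac m (fun i => K m i ≤ (99 / 100) ^ m) := by
  have hlim := (tendsto_pow_atTop_nhds_zero_of_lt_one (r := (99 / 100 : ℝ)) (by norm_num)
    (by norm_num)).eventually (gt_mem_nhds one_half_pos)
  filter_upwards [hlim] with m hm
  set x : ℝ := (99 / 100) ^ m with hx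
  have hx0 : 0 < x := by positivity
  have hbad : frac m (fun i => x ≤ √(Z m i * K m i)) ≤ x := by
    have h1 := (frac_mul_le_avg (c := x) (f := fun i => √(Z m i * K m i))
      (fun i => Real.sqrt_nonneg _) (P := fun i => x ≤ √(Z m i * K m i))
      fun i hi => hi).trans (h.avg_sqrt_le m)
    rw [← pow_mul, mul_comm 2, pow_mul, ← hx, sq] at h1
    exact le_of_mul_le_mul_left h1 hx0
  have h2 : 1 ≤ frac m (fun i => x ≤ √(Z m i * K m i)) +
      frac m (fun i => Z m i ≤ x ∨ K m i ≤ x) := by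
    refine one_le_frac_add fun i => ?_
    by_cases hi : x ≤ √(Z m i * K m i)
    · exact Or.inl hi
    right
    by_contra! hc
    rw [not_le, Real.sqrt_lt' hx0] at hi
    have h3 := h.one_le_add m i
    rcases le_total (Z m i) (K m i) with h4 | h4 <;> nlinarith
  have h3 := frac_le_add (k := m) (P := fun i => Z m i ≤ x ∨ K m i ≤ x)
    (Q := fun i => Z m i ≤ x) (R := fun i => K m i ≤ x) fun i hi => hi
  linarith

lemma frac_K_mul_le (h : PolarProcess Z K H) (m : ℕ) {x : ℝ} :
    (1 - x) * frac m (fun i => K m i ≤ x) ≤ H 0 0 := by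
  rw [← h.avg_H m]
  refine frac_mul_le_avg (fun i => ?_) fun i hi => ?_
  · have := h.one_sub_K_le m i
    nlinarith [h.sq_add_sq_le m i, h.Z_nonneg m i]
  · linarith [h.one_sub_K_le m i]

lemma frac_Z_mul_le (h : PolarProcess Z K H) (m : ℕ) {x : ℝ} :
    (1 - 3 * x) * frac m (fun i => Z m i ≤ x) ≤ 1 - H 0 0 := by
  have h1 : avg m (fun i => 1 - H m i) = 1 - H 0 0 := by
    simp only [sub_eq_add_neg]
    rw [avg_add (fun _ => 1) (fun i => -H m i), avg_const, ← h.avg_H m]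
    simp [avg, neg_div]
  rw [← h1]
  refine frac_mul_le_avg (fun i => ?_) fun i hi => ?_
  · linarith [h.H_le_one m i]
  · linarith [h.H_le_Z m i]

lemma eventually_frac_Z_geometric (h : PolarProcess Z K H) {ε : ℝ} (hε : 0 < ε) :
    ∀ᶠ m in Filter.atTop, 1 - H 0 0 - ε ≤ frac m (fun i => Z m i ≤ (99 / 100) ^ m) := by
  have hlim := (tendsto_pow_atTop_nhds_zero_of_lt_one (r := (99 / 100 : ℝ)) (by norm_num)
    (by norm_num)).eventually (gt_mem_nhds (half_pos hε))
  filter_upwards [hlim, h.eventually_polarized] with m h1 h2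
  have h3 := h.frac_K_mul_le m (x := (99 / 100) ^ m)
  have h4 := frac_le_one (fun i => K m i ≤ (99 / 100) ^ m)
  have h5 : (0 : ℝ) < (99 / 100) ^ m := by positivity
  nlinarith

lemma eventually_frac_K_geometric (h : PolarProcess Z K H) {ε : ℝ} (hε : 0 < ε) :
    ∀ᶠ m in Filter.atTop, H 0 0 - ε ≤ frac m (fun i => K m i ≤ (99 / 100) ^ m) := by
  have hlim := (tendsto_pow_atTop_nhds_zero_of_lt_one (r := (99 / 100 : ℝ)) (by norm_num)
    (by norm_num)).eventually (gt_mem_nhds (div_pos hε four_pos))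
  filter_upwards [hlim, h.eventually_polarized] with m h1 h2
  have h3 := h.frac_Z_mul_le m (x := (99 / 100) ^ m)
  have h4 := frac_le_one (fun i => Z m i ≤ (99 / 100) ^ m)
  have h5 : (0 : ℝ) < (99 / 100) ^ m := by positivity
  nlinarith

lemma eventually_frac_Z (h : PolarProcess Z K H) {b : ℝ} (hb0 : 0 < b) (hb : b < 1 / 2) {ε : ℝ}
    (hε : 0 < ε) : ∀ᶠ k in Filter.atTop, 1 - H 0 0 - ε ≤
      frac k (fun i => Z k i ≤ Real.rpow 2 (-(Real.rpow ((2 ^ k : ℕ) : ℝ) b))) :=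
  h.squareOrDouble_Z.eventually_frac_doubly_exponential (by norm_num) (by norm_num)
    (fun _ => h.eventually_frac_Z_geometric) hb0 hb hε

lemma eventually_frac_K (h : PolarProcess Z K H) {b : ℝ} (hb0 : 0 < b) (hb : b < 1 / 2) {ε : ℝ}
    (hε : 0 < ε) : ∀ᶠ k in Filter.atTop, H 0 0 - ε ≤
      frac k (fun i => K k i ≤ Real.rpow 2 (-(Real.rpow ((2 ^ k : ℕ) : ℝ) b))) :=
  h.squareOrDouble_K.eventually_frac_doubly_exponential (by norm_num) (by norm_num)
    (fun _ => h.eventually_frac_K_geometric) hb0 hb hε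

/-- Two polarization processes with `Z ≤ Z'`: the fraction of nodes where `Z'` is close to one and
`Z` is close to zero tends to the difference of the entropies. -/
theorem tendsto_frac {Z' K' H' : ∀ k, Fin (2 ^ k) → ℝ} (h : PolarProcess Z K H)
    (h' : PolarProcess Z' K' H') (hZ : ∀ k i, Z k i ≤ Z' k i) {b : ℝ} (hb0 : 0 < b)
    (hb : b < 1 / 2) :
    Filter.Tendsto (fun k => frac k (fun i =>
        1 - Real.rpow 2 (-(Real.rpow ((2 ^ k : ℕ) : ℝ) b)) ≤ Z' k i ∧
          Z k i ≤ Real.rpow 2 (-(Real.rpow ((2 ^ k : ℕ) : ℝ) b))))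
      Filter.atTop (nhds (H' 0 0 - H 0 0)) := by
  rw [Metric.tendsto_nhds]
  intro ε hε
  have hε3 : 0 < ε / 3 := by positivity
  filter_upwards [h.eventually_frac_Z hb0 hb hε3, h.eventually_frac_K hb0 hb hε3,
    h'.eventually_frac_Z hb0 hb hε3, h'.eventually_frac_K hb0 hb hε3,
    Filter.eventually_ge_atTop 1] with k h1 h2 h3 h4 hk
  have hδ : Real.rpow 2 (-(Real.rpow ((2 ^ k : ℕ) : ℝ) b)) < 1 / 2 := by
    have h5 : 1 < Real.rpow ((2 ^ k : ℕ) : ℝ) b := by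
      refine Real.one_lt_rpow ?_ hb0
      exact_mod_cast Nat.one_lt_two_pow (by omega)
    calc (2 : ℝ) ^ (-(Real.rpow ((2 ^ k : ℕ) : ℝ) b)) < (2 : ℝ) ^ (-1 : ℝ) :=
          Real.rpow_lt_rpow_of_exponent_lt (by norm_num) (by linarith)
      _ = 1 / 2 := by rw [Real.rpow_neg_one, one_div]
  set δ := Real.rpow 2 (-(Real.rpow ((2 ^ k : ℕ) : ℝ) b)) with hδd
  have h6 := frac_and (k := k) (fun i => 1 - δ ≤ Z' k i) (fun i => Z k i ≤ δ)
  have h7 : frac k (fun i => K' k i ≤ δ) ≤ frac k (fun i => 1 - δ ≤ Z' k i) :=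
    frac_mono fun i hi => by linarith [h'.one_le_add k i]
  have h8 := frac_add_le_one (k := k) (P := fun i => 1 - δ ≤ Z' k i ∧ Z k i ≤ δ)
    (Q := fun i => K k i ≤ δ) (R := fun i => Z' k i ≤ δ)
    (fun i hi hi' => by linarith [h.one_le_add k i, hi.2])
    (fun i hi hi' => by linarith [hi.1])
    (fun i hi hi' => by linarith [h.one_le_add k i, hZ k i])
  rw [Real.dist_eq, abs_lt]
  constructor <;> linarith

end PolarProcess

/-- Summand of the Bhattacharyya parameter. -/
def bhatTerm (a b : ℝ) : ℝ := 2 * √(a * b)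

/-- Summand of the variational distance. -/
def varTerm (a b : ℝ) : ℝ := |a - b|

/-- Summand of the conditional entropy (base 2) of a binary random variable. -/
def entTerm (a b : ℝ) : ℝ :=
  (Real.negMulLog a + Real.negMulLog b - Real.negMulLog (a + b)) / Real.log 2

lemma bhatTerm_nonneg (a b : ℝ) : 0 ≤ bhatTerm a b := by unfold bhatTerm; positivity

lemma varTerm_nonneg (a b : ℝ) : 0 ≤ varTerm a b := abs_nonneg _

lemma bhatTerm_plus {a b c d : ℝ} (ha : 0 ≤ a) (hb : 0 ≤ b) :
    bhatTerm (a * c) (b * d) + bhatTerm (b * c) (a * d) = bhatTerm a b * bhatTerm c d := by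
  unfold bhatTerm
  rw [show a * c * (b * d) = (a * b) * (c * d) by ring,
    show b * c * (a * d) = (a * b) * (c * d) by ring, Real.sqrt_mul (mul_nonneg ha hb)]
  ring

lemma bhatTerm_minus {a b c d : ℝ} (ha : 0 ≤ a) (hb : 0 ≤ b) (hc : 0 ≤ c) (hd : 0 ≤ d) :
    bhatTerm (a * c + b * d) (b * c + a * d) ≤
      bhatTerm a b * (c + d) + (a + b) * bhatTerm c d - bhatTerm a b * bhatTerm c d := by
  unfold bhatTerm
  obtain ⟨x, hx, rfl⟩ : ∃ x, 0 ≤ x ∧ x ^ 2 = a := ⟨√a, Real.sqrt_nonneg _, Real.sq_sqrt ha⟩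
  obtain ⟨y, hy, rfl⟩ : ∃ x, 0 ≤ x ∧ x ^ 2 = b := ⟨√b, Real.sqrt_nonneg _, Real.sq_sqrt hb⟩
  obtain ⟨z, hz, rfl⟩ : ∃ x, 0 ≤ x ∧ x ^ 2 = c := ⟨√c, Real.sqrt_nonneg _, Real.sq_sqrt hc⟩
  obtain ⟨w, hw, rfl⟩ : ∃ x, 0 ≤ x ∧ x ^ 2 = d := ⟨√d, Real.sqrt_nonneg _, Real.sq_sqrt hd⟩
  rw [← mul_pow, ← mul_pow, ← mul_pow, ← mul_pow, ← mul_pow, ← mul_pow,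
    Real.sqrt_sq (by positivity), Real.sqrt_sq (by positivity)]
  have h : √(((x * z) ^ 2 + (y * w) ^ 2) * ((y * z) ^ 2 + (x * w) ^ 2)) ≤
      x * y * (z ^ 2 + w ^ 2) + (x ^ 2 + y ^ 2) * (z * w) - 2 * (x * y) * (z * w) := by
    have hpos : 0 ≤ x * y * (z ^ 2 + w ^ 2) + (x - y) ^ 2 * (z * w) := by positivity
    refine Real.sqrt_le_iff.2 ⟨by linarith, ?_⟩
    have h1 : 0 ≤ 2 * (x * y) * (z * w) * ((x - y) ^ 2 * (z - w) ^ 2) := by positivity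
    linarith
  linarith

lemma varTerm_minus (a b c d : ℝ) :
    varTerm (a * c + b * d) (b * c + a * d) = varTerm a b * varTerm c d := by
  unfold varTerm
  rw [← abs_mul]
  congr 1; ring

lemma varTerm_plus {a b c d : ℝ} (ha : 0 ≤ a) (hb : 0 ≤ b) (hc : 0 ≤ c) (hd : 0 ≤ d) :
    varTerm (a * c) (b * d) + varTerm (b * c) (a * d) ≤
      varTerm a b * (c + d) + (a + b) * varTerm c d - varTerm a b * varTerm c d := by
  unfold varTerm
  have h1 := mul_nonneg ha hc
  have h2 := mul_nonneg ha hd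
  have h3 := mul_nonneg hb hc
  have h4 := mul_nonneg hb hd
  rcases abs_cases (a * c - b * d) with h5 | h5 <;> rcases abs_cases (b * c - a * d) with h6 | h6 <;>
  rcases abs_cases (a - b) with h7 | h7 <;> rcases abs_cases (c - d) with h8 | h8 <;>
  rw [h5.1, h6.1, h7.1, h8.1] <;> nlinarith

lemma entTerm_add (a b c d : ℝ) :
    entTerm (a * c + b * d) (b * c + a * d) + (entTerm (a * c) (b * d) + entTerm (b * c) (a * d)) =
      entTerm a b * (c + d) + (a + b) * entTerm c d := by
  unfold entTerm
  have h : a * c + b * d + (b * c + a * d) = (a + b) * (c + d) := by ring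
  rw [h, Real.negMulLog_mul a c, Real.negMulLog_mul b d, Real.negMulLog_mul b c,
    Real.negMulLog_mul a d, Real.negMulLog_mul (a + b) (c + d)]
  ring

lemma one_le_bhatTerm_add_varTerm {a b : ℝ} (ha : 0 ≤ a) (hb : 0 ≤ b) :
    a + b ≤ bhatTerm a b + varTerm a b := by
  unfold bhatTerm varTerm
  rcases le_total a b with h | h
  · have : a ≤ √(a * b) := Real.le_sqrt_of_sq_le (by nlinarith)
    rw [abs_of_nonpos (by linarith)]; linarith
  · have : b ≤ √(a * b) := Real.le_sqrt_of_sq_le (by nlinarith)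
    rw [abs_of_nonneg (by linarith)]; linarith

lemma entTerm_eq_mul_log {a b : ℝ} (ha : 0 < a) (hb : 0 < b) :
    entTerm a b * Real.log 2 = a * Real.log ((a + b) / a) + b * Real.log ((a + b) / b) := by
  have h2 : Real.log 2 ≠ 0 := (Real.log_pos (by norm_num)).ne'
  rw [entTerm, div_mul_cancel₀ _ h2, Real.log_div (by positivity) ha.ne',
    Real.log_div (by positivity) hb.ne']
  simp only [Real.negMulLog]
  ring

lemma entTerm_comm (a b : ℝ) : entTerm a b = entTerm b a := by
  unfold entTerm; rw [add_comm a b, add_comm (Real.negMulLog a)]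

lemma entTerm_zero_left (b : ℝ) : entTerm 0 b = 0 := by simp [entTerm]

lemma entTerm_le_add {a b : ℝ} (ha : 0 ≤ a) (hb : 0 ≤ b) : entTerm a b ≤ a + b := by
  rcases ha.eq_or_lt with rfl | ha
  · simpa [entTerm_zero_left] using hb
  rcases hb.eq_or_lt with rfl | hb
  · rw [entTerm_comm, entTerm_zero_left]; linarith
  have h2 : 0 < Real.log 2 := Real.log_pos (by norm_num)
  refine le_of_mul_le_mul_right ?_ h2
  rw [entTerm_eq_mul_log ha hb]
  have key : ∀ {x s : ℝ}, 0 < x → 0 < s → x * Real.log (s / x) ≤ x * Real.log 2 + (s / 2 - x) := by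
    intro x s hx hs
    have h3 := Real.log_le_sub_one_of_pos (x := s / x / 2) (by positivity)
    rw [Real.log_div (by positivity) (by norm_num)] at h3
    have h4 := mul_le_mul_of_nonneg_left h3 hx.le
    have h5 : x * (s / x / 2 - 1) = s / 2 - x := by field_simp
    linarith
  have h6 := key ha (add_pos ha hb)
  have h7 := key hb (add_pos ha hb)
  linarith

lemma entTerm_le_bhatTerm {a b : ℝ} (ha : 0 ≤ a) (hb : 0 ≤ b) :
    entTerm a b ≤ 3 * bhatTerm a b := by
  have hn := bhatTerm_nonneg a b
  rcases ha.eq_or_lt with rfl | ha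
  · rw [entTerm_zero_left]; linarith
  rcases hb.eq_or_lt with rfl | hb
  · rw [entTerm_comm, entTerm_zero_left]; linarith
  have h2 : 0.6931471803 < Real.log 2 := Real.log_two_gt_d9
  have key : ∀ {x y : ℝ}, 0 < x → 0 < y → x * Real.log ((x + y) / x) ≤ 2 * (√x * √y) := by
    intro x y hx hy
    have hs : √(x + y) ≤ √x + √y := by
      refine Real.sqrt_le_iff.2 ⟨by positivity, ?_⟩
      nlinarith [Real.sq_sqrt hx.le, Real.sq_sqrt hy.le, Real.sqrt_nonneg x, Real.sqrt_nonneg y]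
    have hsx := Real.sqrt_pos.2 hx
    have h3 := Real.log_le_sub_one_of_pos (x := √((x + y) / x)) (by positivity)
    rw [Real.log_sqrt (by positivity), Real.sqrt_div (by positivity)] at h3
    have h4 : √(x + y) / √x - 1 ≤ √y / √x := by
      rw [sub_le_iff_le_add, div_add_one hsx.ne']
      gcongr
      linarith
    have h5 := mul_le_mul_of_nonneg_left (h3.trans h4) hx.le
    have h6 : x * (√y / √x) = √x * √y := by
      field_simp
      rw [Real.sq_sqrt hx.le]
    linarith
  have h6 := key ha hb
  have h7 := key hb ha
  have h8 := entTerm_eq_mul_log ha hb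
  rw [add_comm b a] at h7
  unfold bhatTerm at hn ⊢
  rw [Real.sqrt_mul ha.le] at hn ⊢
  nlinarith

lemma sub_varTerm_le_entTerm {a b : ℝ} (ha : 0 ≤ a) (hb : 0 ≤ b) :
    a + b - varTerm a b ≤ entTerm a b := by
  have h2 : 0 < Real.log 2 := Real.log_pos (by norm_num)
  wlog hab : a ≤ b generalizing a b
  · have := this hb ha (le_of_not_ge hab)
    rwa [varTerm, abs_sub_comm, add_comm, entTerm_comm] at this
  rw [varTerm, abs_of_nonpos (by linarith)]
  rcases ha.eq_or_lt with rfl | ha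
  · rw [entTerm_zero_left]; linarith
  have hb : 0 < b := ha.trans_le hab
  refine le_of_mul_le_mul_right ?_ h2
  rw [entTerm_eq_mul_log ha hb]
  have h3 : Real.log 2 ≤ Real.log ((a + b) / a) :=
    Real.log_le_log (by norm_num) (by rw [le_div_iff₀ ha]; linarith)
  have h4 : a / b * Real.log 2 ≤ Real.log ((a + b) / b) := by
    have h5 := rpow_one_add_le_one_add_mul_self (s := (1 : ℝ)) (by norm_num) (p := a / b)
      (by positivity) ((div_le_one hb).2 hab)
    rw [← Real.log_rpow (by norm_num)]
    refine Real.log_le_log (by positivity) ?_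
    rw [add_div, div_self hb.ne']
    norm_num at h5 ⊢
    linarith
  have h6 := mul_le_mul_of_nonneg_left h3 ha.le
  have h7 := mul_le_mul_of_nonneg_left h4 hb.le
  have h8 : b * (a / b * Real.log 2) = a * Real.log 2 := by field_simp
  linarith

section Sums

variable {α : Type*} [Fintype α] {a b : α → ℝ}

lemma sum_sum_le_of_le {F w : α → ℝ} (hw : ∑ v, w v = 1) {g : α → α → ℝ}
    (h : ∀ u v, g u v ≤ F u * w v + w u * F v - F u * F v) :
    ∑ u, ∑ v, g u v ≤ 2 * (∑ v, F v) - (∑ v, F v) ^ 2 := by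
  refine (Finset.sum_le_sum fun u _ => Finset.sum_le_sum fun v _ => h u v).trans_eq ?_
  simp only [Finset.sum_sub_distrib, Finset.sum_add_distrib, ← Finset.mul_sum, ← Finset.sum_mul, hw]
  ring

lemma sum_bhatTerm_sq_add_le (ha : ∀ v, 0 ≤ a v) (hb : ∀ v, 0 ≤ b v)
    (hab : ∑ v, (a v + b v) = 1) :
    (∑ v, bhatTerm (a v) (b v)) ^ 2 + (∑ v, varTerm (a v) (b v)) ^ 2 ≤ 1 := by
  have hcs := Finset.sum_mul_sq_le_sq_mul_sq Finset.univ (fun v => |√(a v) - √(b v)|)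
    (fun v => √(a v) + √(b v))
  have h1 : ∀ v, |√(a v) - √(b v)| * (√(a v) + √(b v)) = varTerm (a v) (b v) := fun v => by
    have h0 : 0 ≤ √(a v) + √(b v) := by positivity
    rw [varTerm, ← abs_of_nonneg h0, ← abs_mul]
    congr 1
    nlinarith [Real.sq_sqrt (ha v), Real.sq_sqrt (hb v)]
  have h2 : ∀ v, |√(a v) - √(b v)| ^ 2 = (a v + b v) - bhatTerm (a v) (b v) := fun v => by
    rw [sq_abs, bhatTerm, Real.sqrt_mul (ha v)]
    nlinarith [Real.sq_sqrt (ha v), Real.sq_sqrt (hb v)]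
  have h3 : ∀ v, (√(a v) + √(b v)) ^ 2 = (a v + b v) + bhatTerm (a v) (b v) := fun v => by
    rw [bhatTerm, Real.sqrt_mul (ha v)]
    nlinarith [Real.sq_sqrt (ha v), Real.sq_sqrt (hb v)]
  simp only [h1, h2, h3] at hcs
  rw [Finset.sum_sub_distrib, Finset.sum_add_distrib (f := fun v => a v + b v), hab] at hcs
  nlinarith

end Sums

section PushPMF

variable {Ω α : Type*} [Fintype Ω] [DecidableEq α]

lemma pushPMF_nonneg {p : Ω → ℝ} (hp : ∀ ω, 0 ≤ p ω) (f : Ω → α) (v : α) : 0 ≤ pushPMF p f v :=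
  Finset.sum_nonneg fun ω _ => by split_ifs; exacts [hp ω, le_rfl]

lemma pushPMF_minus (p : Ω → ℝ) (U : Ω → ZMod 2) (V : Ω → α) (u : ZMod 2) (v w : α) :
    pushPMF (fun ω : Ω × Ω => p ω.1 * p ω.2)
        (fun ω => (U ω.1 + U ω.2, (V ω.1, V ω.2))) (u, (v, w)) =
      pushPMF p (fun ω => (U ω, V ω)) (u, v) * pushPMF p (fun ω => (U ω, V ω)) (0, w) +
      pushPMF p (fun ω => (U ω, V ω)) (u + 1, v) * pushPMF p (fun ω => (U ω, V ω)) (1, w) := by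
  unfold pushPMF
  rw [Fintype.sum_mul_sum, Fintype.sum_mul_sum, Fintype.sum_prod_type, ← Finset.sum_add_distrib]
  refine Finset.sum_congr rfl fun ω _ => ?_
  rw [← Finset.sum_add_distrib]
  refine Finset.sum_congr rfl fun ω' _ => ?_
  simp only [Prod.mk.injEq]
  by_cases hv : V ω = v <;> by_cases hw : V ω' = w <;> simp only [hv, hw, and_true, and_false,
    if_false, mul_zero, zero_mul, add_zero]
  generalize U ω = x
  generalize U ω' = y
  have h : ∀ x y u : ZMod 2, (x + y = u ↔ x = u ∧ y = 0 ∨ x = u + 1 ∧ y = 1) ∧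
      ¬ (y = 0 ∧ y = 1) := by decide
  obtain ⟨h1, h2⟩ := h x y u
  by_cases y0 : y = 0 <;> by_cases y1 : y = 1 <;> simp_all

lemma pushPMF_plus (p : Ω → ℝ) (U : Ω → ZMod 2) (V : Ω → α) (u s : ZMod 2) (v w : α) :
    pushPMF (fun ω : Ω × Ω => p ω.1 * p ω.2)
        (fun ω => (U ω.2, (U ω.1 + U ω.2, (V ω.1, V ω.2)))) (u, (s, (v, w))) =
      pushPMF p (fun ω => (U ω, V ω)) (s + u, v) * pushPMF p (fun ω => (U ω, V ω)) (u, w) := by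
  unfold pushPMF
  rw [Fintype.sum_mul_sum, Fintype.sum_prod_type]
  refine Finset.sum_congr rfl fun ω _ => Finset.sum_congr rfl fun ω' _ => ?_
  simp only [Prod.mk.injEq, ite_zero_mul_ite_zero]
  generalize U ω = x
  generalize U ω' = y
  have h : ∀ x y u s : ZMod 2, (y = u ∧ x + y = s) ↔ (x = s + u ∧ y = u) := by decide
  congr 1
  rw [← and_assoc, h x y u s]
  exact propext (by tauto)

end PushPMF

lemma sum_zmod_two {M : Type*} [AddCommMonoid M] (g : ZMod 2 → M) : ∑ u, g u = g 0 + g 1 :=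
  Fin.sum_univ_two g

section ObsSum

variable {Ω Ω' α α' : Type*} [Fintype Ω] [Fintype Ω'] [Fintype α] [Fintype α']
  [DecidableEq α] [DecidableEq α']

/-- Sum over the values `v` of `V` of `f (P(U = 0, V = v)) (P(U = 1, V = v))`. -/
def obsSum (f : ℝ → ℝ → ℝ) (p : Ω → ℝ) (U : Ω → ZMod 2) (V : Ω → α) : ℝ :=
  ∑ v, f (pushPMF p (fun ω => (U ω, V ω)) (0, v)) (pushPMF p (fun ω => (U ω, V ω)) (1, v))

lemma obsSum_eq_sum_div (f : ℝ → ℝ → ℝ) (hf : f 0 0 = 0) (p : Ω → ℝ) (U : Ω → ZMod 2)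
    (V : Ω → α) :
    obsSum f p U V = ∑ ω, f (∑ ω', if U ω' = 0 ∧ V ω' = V ω then p ω' else 0)
      (∑ ω', if U ω' = 1 ∧ V ω' = V ω then p ω' else 0) / ∑ ω', if V ω' = V ω then 1 else 0 := by
  rw [← Finset.sum_fiberwise Finset.univ V]
  refine Finset.sum_congr rfl fun v _ => ?_
  rw [Finset.sum_congr rfl (g := fun _ =>
    f (pushPMF p (fun ω => (U ω, V ω)) (0, v)) (pushPMF p (fun ω => (U ω, V ω)) (1, v)) /
      ∑ ω', if V ω' = v then 1 else 0)]
  · rw [Finset.sum_const, nsmul_eq_mul, Finset.sum_boole]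
    by_cases h : (Finset.univ.filter fun ω => V ω = v).card = 0
    · have h' : ∀ ω, V ω ≠ v := by simpa [Finset.filter_eq_empty_iff] using h
      have h0 : ∀ u, pushPMF p (fun ω => (U ω, V ω)) (u, v) = 0 := fun u => by
        simp [pushPMF, h']
      simp [h0, hf]
    · rw [mul_div_cancel₀]
      exact_mod_cast h
  · intro ω hω
    obtain rfl : V ω = v := by simpa using hω
    simp [pushPMF]

lemma obsSum_congr {f : ℝ → ℝ → ℝ} (hf : f 0 0 = 0) (e : Ω' ≃ Ω) {p : Ω → ℝ} {p' : Ω' → ℝ}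
    {U : Ω → ZMod 2} {U' : Ω' → ZMod 2} {V : Ω → α} {V' : Ω' → α'}
    (hp : ∀ ω, p' ω = p (e ω)) (hU : ∀ ω, U' ω = U (e ω))
    (hV : ∀ ω ω', V' ω = V' ω' ↔ V (e ω) = V (e ω')) :
    obsSum f p' U' V' = obsSum f p U V := by
  classical
  rw [obsSum_eq_sum_div f hf, obsSum_eq_sum_div f hf, ← e.sum_comp]
  refine Finset.sum_congr rfl fun ω _ => ?_
  simp only [← e.sum_comp (fun ω' => if V ω' = V (e ω) then (1 : ℝ) else 0),
    ← e.sum_comp (fun ω' => if U ω' = 0 ∧ V ω' = V (e ω) then p ω' else 0),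
    ← e.sum_comp (fun ω' => if U ω' = 1 ∧ V ω' = V (e ω) then p ω' else 0), hp, hU, hV]

lemma sum_pushPMF (p : Ω → ℝ) (f : Ω → α) : ∑ v, pushPMF p f v = ∑ ω, p ω := by
  unfold pushPMF
  rw [Finset.sum_comm]
  simp

lemma sum_pushPMF_pair (p : Ω → ℝ) (U : Ω → ZMod 2) (V : Ω → α) :
    ∑ v, (pushPMF p (fun ω => (U ω, V ω)) (0, v) + pushPMF p (fun ω => (U ω, V ω)) (1, v)) =
      ∑ ω, p ω := by
  rw [← sum_pushPMF p (fun ω => (U ω, V ω)), Fintype.sum_prod_type_right]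
  simp only [sum_zmod_two]

lemma obsSum_minus (f : ℝ → ℝ → ℝ) (p : Ω → ℝ) (U : Ω → ZMod 2) (V : Ω → α) {a b : α → ℝ}
    (ha : ∀ v, a v = pushPMF p (fun ω => (U ω, V ω)) (0, v))
    (hb : ∀ v, b v = pushPMF p (fun ω => (U ω, V ω)) (1, v)) :
    obsSum f (fun ω : Ω × Ω => p ω.1 * p ω.2) (fun ω => U ω.1 + U ω.2)
        (fun ω => (V ω.1, V ω.2)) =
      ∑ v, ∑ w, f (a v * a w + b v * b w) (b v * a w + a v * b w) := by
  rw [obsSum, Fintype.sum_prod_type]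
  simp only [pushPMF_minus, ha, hb, zero_add, CharTwo.add_self_eq_zero]

lemma obsSum_plus (f : ℝ → ℝ → ℝ) (p : Ω → ℝ) (U : Ω → ZMod 2) (V : Ω → α) {a b : α → ℝ}
    (ha : ∀ v, a v = pushPMF p (fun ω => (U ω, V ω)) (0, v))
    (hb : ∀ v, b v = pushPMF p (fun ω => (U ω, V ω)) (1, v)) :
    obsSum f (fun ω : Ω × Ω => p ω.1 * p ω.2) (fun ω => U ω.2)
        (fun ω => (U ω.1 + U ω.2, (V ω.1, V ω.2))) =
      ∑ v, ∑ w, (f (a v * a w) (b v * b w) + f (b v * a w) (a v * b w)) := by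
  rw [obsSum, Fintype.sum_prod_type, sum_zmod_two, Fintype.sum_prod_type, Fintype.sum_prod_type,
    ← Finset.sum_add_distrib]
  simp only [← Finset.sum_add_distrib]
  simp only [pushPMF_plus, ha, hb, zero_add, add_zero, CharTwo.add_self_eq_zero]

lemma obsSum_bhatTerm_le {p : Ω → ℝ} (hp : ∀ ω, 0 ≤ p ω) (U : Ω → ZMod 2) (V : Ω → α)
    (W : Ω → α') : obsSum bhatTerm p U (fun ω => (V ω, W ω)) ≤ obsSum bhatTerm p U W := by
  rw [obsSum, Fintype.sum_prod_type_right]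
  refine Finset.sum_le_sum fun w _ => ?_
  have h : ∀ u, pushPMF p (fun ω => (U ω, W ω)) (u, w) =
      ∑ v, pushPMF p (fun ω => (U ω, (V ω, W ω))) (u, (v, w)) := fun u => by
    unfold pushPMF
    rw [Finset.sum_comm]
    refine Finset.sum_congr rfl fun ω _ => ?_
    by_cases h1 : U ω = u <;> by_cases h2 : W ω = w <;> simp [h1, h2]
  simp only [bhatTerm, h, ← Finset.mul_sum]
  gcongr
  have h0 : ∀ u v, 0 ≤ pushPMF p (fun ω => (U ω, (V ω, W ω))) (u, (v, w)) := fun u v =>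
    pushPMF_nonneg hp _ _
  simp only [Real.sqrt_mul (h0 _ _), Real.sqrt_mul (Finset.sum_nonneg fun v _ => h0 _ v)]
  exact Real.sum_sqrt_mul_sqrt_le _ (fun v => h0 0 v) (fun v => h0 1 v)

lemma condEntOf_eq_obsSum {p : Ω → ℝ} (hp : ∀ ω, 0 ≤ p ω) (U : Ω → ZMod 2) (V : Ω → α) :
    condEntOf p U V = obsSum entTerm p U V := by
  rw [condEntOf, condEnt, Finset.sum_comm, ← Finset.sum_neg_distrib]
  refine Finset.sum_congr rfl fun v _ => ?_
  have ha := pushPMF_nonneg hp (fun ω => (U ω, V ω)) (0, v)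
  have hb := pushPMF_nonneg hp (fun ω => (U ω, V ω)) (1, v)
  rw [sum_zmod_two, margSnd, sum_zmod_two]
  set a := pushPMF p (fun ω => (U ω, V ω)) (0, v)
  set b := pushPMF p (fun ω => (U ω, V ω)) (1, v)
  have key : ∀ {x s : ℝ}, 0 ≤ x → x ≤ s →
      x * Real.logb 2 (x / s) = x * (Real.log x - Real.log s) / Real.log 2 := by
    intro x s hx hs
    rcases hx.eq_or_lt with rfl | hx
    · simp
    · rw [Real.logb, Real.log_div hx.ne' (hx.trans_le hs).ne', mul_div_assoc]
  rw [key ha (by linarith), key hb (by linarith), entTerm]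
  simp only [Real.negMulLog]
  ring

lemma entOf_eq_obsSum {p : Ω → ℝ} (hp : IsPMF p) (U : Ω → ZMod 2) :
    entOf p U = obsSum entTerm p U (fun _ => ()) := by
  have h : ∀ u, pushPMF p (fun ω => (U ω, ())) (u, ()) = pushPMF p U u := fun u => by
    simp [pushPMF]
  have h1 := sum_pushPMF p U
  rw [hp.2, sum_zmod_two] at h1
  rw [entOf, ent, obsSum, sum_zmod_two, Fintype.sum_unique]
  change _ = entTerm (pushPMF p (fun ω => (U ω, ())) (0, ())) (pushPMF p (fun ω => (U ω, ())) (1, ()))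
  rw [h, h, entTerm, h1]
  simp only [Real.negMulLog, Real.logb, Real.log_one]
  ring

end ObsSum

lemma polarG_child (k : ℕ) (a c : Fin (2 ^ k)) (b d : Fin 2) :
    polarG (k + 1) (child k (a, b)) (child k (c, d)) =
      polarG k a c * (!![1, 0; 1, 1] : Matrix (Fin 2) (Fin 2) (ZMod 2)) b d := by
  have h : polarG (k + 1) = Matrix.reindex (child k) (child k)
      (Matrix.kroneckerMap (· * ·) (polarG k)
        (!![1, 0; 1, 1] : Matrix (Fin 2) (Fin 2) (ZMod 2))) := rfl
  rw [h, Matrix.reindex_apply, Matrix.submatrix_apply, Equiv.symm_apply_apply,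
    Equiv.symm_apply_apply, Matrix.kroneckerMap_apply]

lemma polarU_child_zero (k : ℕ) (x : Fin (2 ^ (k + 1)) → ZMod 2) (c : Fin (2 ^ k)) :
    polarU (k + 1) x (child k (c, 0)) =
      polarU k (fun j => x (child k (j, 0))) c + polarU k (fun j => x (child k (j, 1))) c := by
  simp only [polarU, Matrix.vecMul, dotProduct]
  rw [← (child k).sum_comp, Fintype.sum_prod_type, ← Finset.sum_add_distrib]
  simp [polarG_child]

lemma polarU_child_one (k : ℕ) (x : Fin (2 ^ (k + 1)) → ZMod 2) (c : Fin (2 ^ k)) :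
    polarU (k + 1) x (child k (c, 1)) = polarU k (fun j => x (child k (j, 1))) c := by
  simp only [polarU, Matrix.vecMul, dotProduct]
  rw [← (child k).sum_comp, Fintype.sum_prod_type]
  simp [polarG_child]

lemma child_val (k : ℕ) (c : Fin (2 ^ k)) (d : Fin 2) :
    (child k (c, d) : ℕ) = d + 2 * c := by
  simp [child]

section Node

variable {β γ : Type*}

/-- The realizations of the `2 ^ k` source bits and of the corresponding outputs. -/
abbrev Block (β : Type*) (k : ℕ) := (Fin (2 ^ k) → ZMod 2) × (Fin (2 ^ k) → β)

/-- Splitting a block into its even and odd positions. -/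
def splitBlock (β : Type*) (k : ℕ) :
    Block β (k + 1) ≃ Block β k × Block β k where
  toFun ω := ((fun j => ω.1 (child k (j, 0)), fun j => ω.2 (child k (j, 0))),
    (fun j => ω.1 (child k (j, 1)), fun j => ω.2 (child k (j, 1))))
  invFun w :=
    (fun i => if ((child k).symm i).2 = 0 then w.1.1 ((child k).symm i).1
        else w.2.1 ((child k).symm i).1,
      fun i => if ((child k).symm i).2 = 0 then w.1.2 ((child k).symm i).1
        else w.2.2 ((child k).symm i).1)
  left_inv ω := by
    ext i <;> obtain ⟨⟨c, d⟩, rfl⟩ := (child k).surjective i <;> fin_cases d <;> simp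
  right_inv w := by simp

lemma iidPair_splitBlock [Fintype β] (p : ZMod 2 × β → ℝ) (k : ℕ)
    (ω : Block β (k + 1)) :
    iidPair p (2 ^ (k + 1)) ω =
      iidPair p (2 ^ k) (splitBlock β k ω).1 * iidPair p (2 ^ k) (splitBlock β k ω).2 := by
  simp only [iidPair]
  rw [← (child k).prod_comp, Fintype.prod_prod_type, ← Finset.prod_mul_distrib]
  simp [splitBlock]

/-- The pair of the observed outputs and of the bits preceding `U^i`. -/
def observation (obs : β → γ) (k : ℕ) (i : Fin (2 ^ k))
    (xy : Block β k) :
    (Fin (2 ^ k) → γ) × (Fin i.val → ZMod 2) :=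
  (fun j => obs (xy.2 j), fun j => polarU k xy.1 (Fin.castLE i.isLt.le j))

lemma isPMF_iidPair [Fintype β] {p : ZMod 2 × β → ℝ} (hp : IsPMF p) (n : ℕ) : IsPMF (iidPair p n) := by
  refine ⟨fun ω => Finset.prod_nonneg fun i _ => hp.1 _, ?_⟩
  have h := Fintype.prod_sum (fun (_ : Fin n) (z : ZMod 2 × β) => p z)
  rw [hp.2, Finset.prod_const_one] at h
  rw [h, ← (Equiv.arrowProdEquivProdArrow (Fin n) (fun _ => ZMod 2) (fun _ => β)).sum_comp]
  rfl

/-- The joint pmf of `U^i` and its observation. -/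
def nodePMF [Fintype β] [DecidableEq γ] (p : ZMod 2 × β → ℝ) (obs : β → γ) (k : ℕ) (i : Fin (2 ^ k)) (u : ZMod 2)
    (v : (Fin (2 ^ k) → γ) × (Fin i.val → ZMod 2)) : ℝ :=
  pushPMF (iidPair p (2 ^ k)) (fun ω => (polarU k ω.1 i, observation obs k i ω)) (u, v)

lemma nodePMF_nonneg [Fintype β] [DecidableEq γ] {p : ZMod 2 × β → ℝ} (hp : IsPMF p)
    (obs : β → γ) (k : ℕ) (i : Fin (2 ^ k)) (u : ZMod 2) (v : (Fin (2 ^ k) → γ) × (Fin i.val → ZMod 2)) : 0 ≤ nodePMF p obs k i u v :=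
  pushPMF_nonneg (isPMF_iidPair hp _).1 _ _

/-- The sum over the observations of `f` applied to the joint pmf at `U^i = 0` and `U^i = 1`. -/
def nodeSum [Fintype β] [Fintype γ] [DecidableEq γ] (f : ℝ → ℝ → ℝ) (p : ZMod 2 × β → ℝ) (obs : β → γ)
    (k : ℕ) (i : Fin (2 ^ k)) : ℝ :=
  obsSum f (iidPair p (2 ^ k)) (fun xy => polarU k xy.1 i) (observation obs k i)

lemma observation_eq_iff (obs : β → γ) (k : ℕ) (i : Fin (2 ^ k))
    (ω ω' : Block β k) :
    observation obs k i ω = observation obs k i ω' ↔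
      (∀ j, obs (ω.2 j) = obs (ω'.2 j)) ∧
        ∀ j : Fin (2 ^ k), j.val < i.val → polarU k ω.1 j = polarU k ω'.1 j := by
  simp only [observation, Prod.mk.injEq, funext_iff]
  refine and_congr_right fun _ => ⟨fun h j hj => h ⟨j, hj⟩, fun h j => h _ j.2⟩

lemma forall_child {k : ℕ} {P : Fin (2 ^ (k + 1)) → Prop} :
    (∀ i, P i) ↔ ∀ c, P (child k (c, 0)) ∧ P (child k (c, 1)) := by
  rw [← (child k).forall_congr_right, Prod.forall]
  simp only [Fin.forall_fin_two]

lemma observation_minus_iff (obs : β → γ) (k : ℕ) (c : Fin (2 ^ k))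
    (ω ω' : Block β (k + 1)) :
    observation obs (k + 1) (child k (c, 0)) ω = observation obs (k + 1) (child k (c, 0)) ω' ↔
      (observation obs k c (splitBlock β k ω).1, observation obs k c (splitBlock β k ω).2) =
        (observation obs k c (splitBlock β k ω').1,
          observation obs k c (splitBlock β k ω').2) := by
  simp only [Prod.mk.injEq, observation_eq_iff, forall_child, polarU_child_zero, polarU_child_one,
    child_val, splitBlock, Equiv.coe_fn_mk, Fin.val_zero, Fin.val_one, forall_and]
  constructor
  · rintro ⟨⟨h1, h2⟩, h3, h4⟩
    have h5 := fun j (hj : j.val < c.val) => h4 j (by omega)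
    exact ⟨⟨h1, fun j hj => by simpa [h5 j hj] using h3 j (by omega)⟩, h2, h5⟩
  · rintro ⟨⟨h1, h2⟩, h3, h4⟩
    exact ⟨⟨h1, h3⟩, fun j hj => by rw [h2 j (by omega), h4 j (by omega)],
      fun j hj => h4 j (by omega)⟩

lemma observation_plus_iff (obs : β → γ) (k : ℕ) (c : Fin (2 ^ k))
    (ω ω' : Block β (k + 1)) :
    observation obs (k + 1) (child k (c, 1)) ω = observation obs (k + 1) (child k (c, 1)) ω' ↔
      (polarU k (splitBlock β k ω).1.1 c + polarU k (splitBlock β k ω).2.1 c,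
        (observation obs k c (splitBlock β k ω).1, observation obs k c (splitBlock β k ω).2)) =
      (polarU k (splitBlock β k ω').1.1 c + polarU k (splitBlock β k ω').2.1 c,
        (observation obs k c (splitBlock β k ω').1,
          observation obs k c (splitBlock β k ω').2)) := by
  refine Iff.trans ?_ ((and_congr_right' (observation_minus_iff obs k c ω ω')).trans
    Prod.mk_inj.symm)
  simp only [observation_eq_iff, forall_child, polarU_child_zero, polarU_child_one,
    child_val, splitBlock, Equiv.coe_fn_mk, Fin.val_zero, Fin.val_one, forall_and]
  constructor
  · rintro ⟨h1, h2, h3⟩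
    exact ⟨h2 c (by omega), h1, fun j hj => h2 j (by omega), fun j hj => h3 j (by omega)⟩
  · rintro ⟨h0, h1, h2, h3⟩
    refine ⟨h1, fun j hj => ?_, fun j hj => h3 j (by omega)⟩
    rcases eq_or_ne j c with rfl | hjc
    · exact h0
    · have := Fin.val_ne_of_ne hjc
      exact h2 j (by omega)

variable [Fintype β] [Fintype γ] [DecidableEq γ]

lemma polarZobs_eq_nodeSum (p : ZMod 2 × β → ℝ) (obs : β → γ) (k : ℕ) (i : Fin (2 ^ k)) :
    polarZobs p obs k i = nodeSum bhatTerm p obs k i := by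
  rw [polarZobs, bhat, Finset.mul_sum]
  rfl

lemma polarZU_eq_nodeSum (p : ZMod 2 × β → ℝ) (k : ℕ) (i : Fin (2 ^ k)) :
    polarZU p k i = nodeSum bhatTerm p (fun _ => ()) k i := by
  rw [polarZU, bhat, Finset.mul_sum]
  refine obsSum_congr (f := bhatTerm) (by simp [bhatTerm]) (Equiv.refl (Block β k))
    (p' := iidPair p (2 ^ k)) (U' := fun xy => polarU k xy.1 i)
    (fun _ => rfl) (fun _ => rfl)
    fun ω ω' => ?_
  simp [observation]

lemma nodeSum_minus {f : ℝ → ℝ → ℝ} (hf : f 0 0 = 0) (p : ZMod 2 × β → ℝ) (obs : β → γ) (k : ℕ)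
    (c : Fin (2 ^ k)) :
    nodeSum f p obs (k + 1) (child k (c, 0)) =
      obsSum f (fun ω : Block β k × Block β k => iidPair p (2 ^ k) ω.1 * iidPair p (2 ^ k) ω.2)
        (fun ω : Block β k × Block β k => polarU k ω.1.1 c + polarU k ω.2.1 c)
        (fun ω : Block β k × Block β k => (observation obs k c ω.1, observation obs k c ω.2)) :=
  obsSum_congr (p' := iidPair p (2 ^ (k + 1))) hf (splitBlock β k) (iidPair_splitBlock p k)
    (fun ω => polarU_child_zero k ω.1 c) (observation_minus_iff obs k c)

lemma nodeSum_plus {f : ℝ → ℝ → ℝ} (hf : f 0 0 = 0) (p : ZMod 2 × β → ℝ) (obs : β → γ) (k : ℕ)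
    (c : Fin (2 ^ k)) :
    nodeSum f p obs (k + 1) (child k (c, 1)) =
      obsSum f (fun ω : Block β k × Block β k => iidPair p (2 ^ k) ω.1 * iidPair p (2 ^ k) ω.2)
        (fun ω : Block β k × Block β k => polarU k ω.2.1 c)
        (fun ω : Block β k × Block β k => (polarU k ω.1.1 c + polarU k ω.2.1 c,
          (observation obs k c ω.1, observation obs k c ω.2))) :=
  obsSum_congr (p' := iidPair p (2 ^ (k + 1))) hf (splitBlock β k) (iidPair_splitBlock p k)
    (fun ω => polarU_child_one k ω.1 c) (observation_plus_iff obs k c)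

lemma nodeSum_root {f : ℝ → ℝ → ℝ} (hf : f 0 0 = 0) (p : ZMod 2 × β → ℝ) (obs : β → γ) :
    nodeSum f p obs 0 0 = obsSum f p (fun z => z.1) (fun z => obs z.2) := by
  let e : (Fin (2 ^ 0) → ZMod 2) × (Fin (2 ^ 0) → β) ≃ ZMod 2 × β :=
    (Equiv.funUnique (Fin 1) (ZMod 2)).prodCongr (Equiv.funUnique (Fin 1) β)
  refine obsSum_congr hf e (fun ω => ?_) (fun ω => ?_) fun ω ω' => ?_
  · exact Fin.prod_univ_one _
  · simp [polarU, polarG, e]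
  · rw [observation_eq_iff]
    refine ⟨fun h => h.1 0, fun h => ⟨fun j => ?_, fun j hj => absurd hj (Nat.not_lt_zero _)⟩⟩
    obtain rfl : j = (0 : Fin 1) := Subsingleton.elim (α := Fin 1) _ _
    exact h

lemma sum_nodePMF {p : ZMod 2 × β → ℝ} (hp : IsPMF p) (obs : β → γ) (k : ℕ) (i : Fin (2 ^ k)) :
    ∑ v, (nodePMF p obs k i 0 v + nodePMF p obs k i 1 v) = 1 :=
  (sum_pushPMF_pair _ _ _).trans (isPMF_iidPair hp _).2

lemma nodeSum_eq_sum (f : ℝ → ℝ → ℝ) (p : ZMod 2 × β → ℝ) (obs : β → γ) (k : ℕ)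
    (i : Fin (2 ^ k)) :
    nodeSum f p obs k i = ∑ v, f (nodePMF p obs k i 0 v) (nodePMF p obs k i 1 v) :=
  rfl

lemma nodeSum_child_zero {f : ℝ → ℝ → ℝ} (hf : f 0 0 = 0) (p : ZMod 2 × β → ℝ) (obs : β → γ)
    (k : ℕ) (i : Fin (2 ^ k)) :
    nodeSum f p obs (k + 1) (child k (i, 0)) =
      ∑ v, ∑ w, f (nodePMF p obs k i 0 v * nodePMF p obs k i 0 w +
          nodePMF p obs k i 1 v * nodePMF p obs k i 1 w)
        (nodePMF p obs k i 1 v * nodePMF p obs k i 0 w +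
          nodePMF p obs k i 0 v * nodePMF p obs k i 1 w) :=
  (nodeSum_minus hf p obs k i).trans
    (obsSum_minus f (iidPair p (2 ^ k)) (fun ω : Block β k => polarU k ω.1 i)
      (observation obs k i) (fun _ => rfl) (fun _ => rfl))

lemma nodeSum_child_one {f : ℝ → ℝ → ℝ} (hf : f 0 0 = 0) (p : ZMod 2 × β → ℝ) (obs : β → γ)
    (k : ℕ) (i : Fin (2 ^ k)) :
    nodeSum f p obs (k + 1) (child k (i, 1)) =
      ∑ v, ∑ w, (f (nodePMF p obs k i 0 v * nodePMF p obs k i 0 w)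
          (nodePMF p obs k i 1 v * nodePMF p obs k i 1 w) +
        f (nodePMF p obs k i 1 v * nodePMF p obs k i 0 w)
          (nodePMF p obs k i 0 v * nodePMF p obs k i 1 w)) :=
  (nodeSum_plus hf p obs k i).trans
    (obsSum_plus f (iidPair p (2 ^ k)) (fun ω : Block β k => polarU k ω.1 i)
      (observation obs k i) (fun _ => rfl) (fun _ => rfl))

/-- The Bhattacharyya parameters, variational distances and conditional entropies obtained from the
polar construction form a polarization process. -/
theorem polarProcess_nodeSum {p : ZMod 2 × β → ℝ} (hp : IsPMF p) (obs : β → γ) :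
    PolarProcess (nodeSum bhatTerm p obs) (nodeSum varTerm p obs) (nodeSum entTerm p obs) := by
  have hZ0 : bhatTerm 0 0 = 0 := by simp [bhatTerm]
  have hK0 : varTerm 0 0 = 0 := by simp [varTerm]
  have hH0 : entTerm 0 0 = 0 := entTerm_zero_left 0
  have hq := nodePMF_nonneg hp obs
  have hsum := sum_nodePMF hp obs
  have hnode := fun f => nodeSum_eq_sum f p obs
  have hminus := fun (f : ℝ → ℝ → ℝ) (hf : f 0 0 = 0) => nodeSum_child_zero hf p obs
  have hplus := fun (f : ℝ → ℝ → ℝ) (hf : f 0 0 = 0) => nodeSum_child_one hf p obs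
  constructor
  · exact fun k i => Finset.sum_nonneg fun v _ => bhatTerm_nonneg _ _
  · exact fun k i => Finset.sum_nonneg fun v _ => varTerm_nonneg _ _
  · exact fun k i => sum_bhatTerm_sq_add_le (hq k i 0) (hq k i 1) (hsum k i)
  · intro k i
    rw [hnode, hnode, ← hsum k i, ← Finset.sum_add_distrib]
    exact Finset.sum_le_sum fun v _ => one_le_bhatTerm_add_varTerm (hq _ _ _ _) (hq _ _ _ _)
  · intro k i
    rw [hminus _ hZ0, hnode]
    exact sum_sum_le_of_le (hsum k i) fun u v =>
      bhatTerm_minus (hq _ _ _ _) (hq _ _ _ _) (hq _ _ _ _) (hq _ _ _ _)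
  · intro k i
    rw [hplus _ hZ0, hnode, sq, Fintype.sum_mul_sum]
    exact Finset.sum_congr rfl fun u _ => Finset.sum_congr rfl fun v _ =>
      bhatTerm_plus (hq _ _ _ _) (hq _ _ _ _)
  · intro k i
    rw [hminus _ hK0, hnode, sq, Fintype.sum_mul_sum]
    exact Finset.sum_congr rfl fun u _ => Finset.sum_congr rfl fun v _ => varTerm_minus _ _ _ _
  · intro k i
    rw [hplus _ hK0, hnode]
    exact sum_sum_le_of_le (hsum k i) fun u v =>
      varTerm_plus (hq _ _ _ _) (hq _ _ _ _) (hq _ _ _ _) (hq _ _ _ _)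
  · intro k i
    rw [hminus _ hH0, hplus _ hH0, ← Finset.sum_add_distrib]
    simp only [← Finset.sum_add_distrib, entTerm_add]
    simp only [Finset.sum_add_distrib (f := fun _ => entTerm _ _ * _), ← Finset.mul_sum,
      ← Finset.sum_mul, hsum k i]
    rw [hnode]; ring
  · intro k i
    rw [← hsum k i]
    exact Finset.sum_le_sum fun v _ => entTerm_le_add (hq _ _ _ _) (hq _ _ _ _)
  · intro k i
    rw [hnode, hnode, Finset.mul_sum]
    exact Finset.sum_le_sum fun v _ => entTerm_le_bhatTerm (hq _ _ _ _) (hq _ _ _ _)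
  · intro k i
    rw [hnode, hnode, ← hsum k i, ← Finset.sum_sub_distrib]
    exact Finset.sum_le_sum fun v _ => sub_varTerm_le_entTerm (hq _ _ _ _) (hq _ _ _ _)

lemma nodeSum_bhatTerm_le {p : ZMod 2 × β → ℝ} (hp : IsPMF p) (obs : β → γ) (k : ℕ)
    (i : Fin (2 ^ k)) :
    nodeSum bhatTerm p obs k i ≤ nodeSum bhatTerm p (fun _ => ()) k i :=
  (obsSum_bhatTerm_le (isPMF_iidPair hp _).1 _ _ _).trans_eq <| Eq.symm <|
    obsSum_congr (by simp [bhatTerm]) (Equiv.refl _) (fun _ => rfl) (fun _ => rfl) fun ω ω' => by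
      simp [observation]

/-- Polarization of a source `X` observed through `obs Y`: the fraction of the indices that have
high entropy without the observation and low entropy with it tends to `I(X; obs Y)`. -/
theorem tendsto_card_information_set {p : ZMod 2 × β → ℝ} (hp : IsPMF p) (obs : β → γ) {b : ℝ}
    (hb0 : 0 < b) (hb : b < 1 / 2) :
    Filter.Tendsto (fun k : ℕ =>
        (Nat.card {i : Fin (2 ^ k) //
            1 - Real.rpow 2 (-(Real.rpow ((2 ^ k : ℕ) : ℝ) b)) ≤ polarZU p k i ∧
            polarZobs p obs k i ≤ Real.rpow 2 (-(Real.rpow ((2 ^ k : ℕ) : ℝ) b))} : ℝ)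
          / ((2 ^ k : ℕ) : ℝ))
      Filter.atTop (nhds (mutInfoOf p (fun ω => ω.1) (fun ω => obs ω.2))) := by
  have h := (polarProcess_nodeSum hp obs).tendsto_frac (polarProcess_nodeSum hp fun _ => ())
    (nodeSum_bhatTerm_le hp obs) hb0 hb
  simp only [natCard_div_eq_frac, polarZU_eq_nodeSum, polarZobs_eq_nodeSum]
  rw [mutInfoOf, entOf_eq_obsSum hp, condEntOf_eq_obsSum hp.1]
  rwa [nodeSum_root (entTerm_zero_left 0), nodeSum_root (entTerm_zero_left 0)] at h

end Node

/-- for the broadcast channel `W` with binary input pmf `PX`, the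
information sets `I_m = H_U^{(n)} ∩ L^{(n)}_{U|Y_m}` satisfy `|I_m|/n → I(X;Y_m)`. -/
theorem polar_information_sets_bc {Y1 Y2 : Type*} [Fintype Y1] [Fintype Y2]
    [DecidableEq Y1] [DecidableEq Y2]
    (PX : ZMod 2 → ℝ) (hPX : IsPMF PX)
    (W : ZMod 2 → Y1 × Y2 → ℝ) (hW : ∀ x, IsPMF (W x))
    (b : ℝ) (hb0 : 0 < b) (hb : b < 1 / 2) :
    Filter.Tendsto (fun k : ℕ =>
        (Nat.card {i : Fin (2 ^ k) //
            1 - Real.rpow 2 (-(Real.rpow ((2 ^ k : ℕ) : ℝ) b)) ≤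
              polarZU (fun xy : ZMod 2 × (Y1 × Y2) => PX xy.1 * W xy.1 xy.2) k i ∧
            polarZobs (fun xy : ZMod 2 × (Y1 × Y2) => PX xy.1 * W xy.1 xy.2)
                (fun y => y.1) k i ≤
              Real.rpow 2 (-(Real.rpow ((2 ^ k : ℕ) : ℝ) b))} : ℝ)
          / ((2 ^ k : ℕ) : ℝ))
      Filter.atTop
      (nhds (mutInfoOf (fun xy : ZMod 2 × (Y1 × Y2) => PX xy.1 * W xy.1 xy.2)
        (fun ω => ω.1) (fun ω => ω.2.1))) ∧
    Filter.Tendsto (fun k : ℕ =>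
        (Nat.card {i : Fin (2 ^ k) //
            1 - Real.rpow 2 (-(Real.rpow ((2 ^ k : ℕ) : ℝ) b)) ≤
              polarZU (fun xy : ZMod 2 × (Y1 × Y2) => PX xy.1 * W xy.1 xy.2) k i ∧
            polarZobs (fun xy : ZMod 2 × (Y1 × Y2) => PX xy.1 * W xy.1 xy.2)
                (fun y => y.2) k i ≤
              Real.rpow 2 (-(Real.rpow ((2 ^ k : ℕ) : ℝ) b))} : ℝ)
          / ((2 ^ k : ℕ) : ℝ))
      Filter.atTop
      (nhds (mutInfoOf (fun xy : ZMod 2 × (Y1 × Y2) => PX xy.1 * W xy.1 xy.2)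
        (fun ω => ω.1) (fun ω => ω.2.2))) := by
  have hp : IsPMF (fun xy : ZMod 2 × (Y1 × Y2) => PX xy.1 * W xy.1 xy.2) := by
    refine ⟨fun xy => mul_nonneg (hPX.1 _) ((hW _).1 _), ?_⟩
    rw [Fintype.sum_prod_type]
    simp only [← Finset.mul_sum, (hW _).2, mul_one, hPX.2]
  exact ⟨tendsto_card_information_set hp (fun y => y.1) hb0 hb,
    tendsto_card_information_set hp (fun y => y.2) hb0 hb⟩
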